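/- Let I ⊆ ℝ be a nonempty open interval, let x, y : I → ℝ be smooth, let δ ∈ {−1,1} with x'(s)² − y'(s)² = δ for all s ∈ I, and let v₂, v₃ ∈ ℝ with v₂² ≠ v₃². Suppose that (v₂·y'(s) − v₃·x'(s))·(y'(s)·x''(s) − x'(s)·y''(s)) = 2 for all s ∈ I. Then there exists s₀ ∈ ℝ such that for all s ∈ I: v₃·y'(s) − v₂·x'(s) = 2δ(s−s₀), the quadratic relation (v₃² − v₂²)·x'(s)² − 4δ·v₂·(s−s₀)·x'(s) − (4(s−s₀)² + δ·v₃²) = 0 holds, (s−s₀)² + δ(v₃² − v₂²)/4 ≥ 0, and for each s ∈ I there is ε ∈ {−1,1} with x'(s) = (2δ·v₂·(s−s₀) + 2ε·|v₃|·√((s−s₀)² + δ(v₃² − v₂²)/4))/(v₃² − v₂²). -/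

import Mathlib

noncomputable section

open Real

/-- The derivative of a function smooth on an open set is differentiable on that set. -/
lemma hasDerivAt_deriv_of_contDiffOn {I : Set ℝ} (hI : IsOpen I) {f : ℝ → ℝ}
    (hf : ContDiffOn ℝ (⊤ : ℕ∞) f I) {s : ℝ} (hs : s ∈ I) :
    HasDerivAt (deriv f) (deriv (deriv f) s) s := by
  have h1 : ContDiffOn ℝ 1 (deriv f) I :=
    hf.deriv_of_isOpen hI (WithTop.coe_le_coe.mpr (le_top : (1 + 1 : ℕ∞) ≤ ⊤))
  exact ((h1.differentiableOn one_ne_zero).differentiableAt (hI.mem_nhds hs)).hasDerivAt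

/-- A real number is `ε` times its absolute value for some sign `ε`. -/
lemma exists_sign_mul_abs (a : ℝ) : ∃ ε : ℝ, (ε = -1 ∨ ε = 1) ∧ a = ε * |a| := by
  rcases le_total 0 a with h | h
  · exact ⟨1, Or.inr rfl, by rw [abs_of_nonneg h, one_mul]⟩
  · exact ⟨-1, Or.inl rfl, by rw [abs_of_nonpos h]; ring⟩

/-- A function with constant derivative `c` on an open interval is affine with slope `c` there. -/
lemma exists_eq_mul_sub_of_hasDerivAt {I : Set ℝ} (hI : IsOpen I) (hIconn : I.OrdConnected)
    {f : ℝ → ℝ} {c : ℝ} (hc : c ≠ 0) (hf : ∀ s ∈ I, HasDerivAt f c s) :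
    ∃ s₀, ∀ s ∈ I, f s = c * (s - s₀) := by
  have hg : ∀ s ∈ I, HasDerivAt (fun s => f s - c * s) 0 s := fun s hs => by
    have h := (hf s hs).sub ((hasDerivAt_id s).const_mul c)
    rw [mul_one, sub_self] at h
    exact h
  obtain ⟨a, ha⟩ := hI.exists_is_const_of_deriv_eq_zero hIconn.isPreconnected
    (fun s hs => (hg s hs).differentiableAt.differentiableWithinAt)
    (fun s hs => (hg s hs).deriv)
  refine ⟨-a / c, fun s hs => ?_⟩
  have := ha s hs
  field_simp
  linarith

/-- cylindrical IMCF translating solitons with spacelike rulings and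
velocity vector with `v₂² ≠ v₃²`: the first derivative equations for the base curve
`γ(s) = (0, x(s), y(s))`. -/
theorem cylindrical_soliton_spacelike_ruling_general_case
    (I : Set ℝ) (hIopen : IsOpen I) (hIne : I.Nonempty) (hIconn : I.OrdConnected)
    (x y : ℝ → ℝ) (hx : ContDiffOn ℝ (⊤ : ℕ∞) x I) (hy : ContDiffOn ℝ (⊤ : ℕ∞) y I)
    (δ : ℝ) (hδ : δ = -1 ∨ δ = 1)
    (harc : ∀ s ∈ I, deriv x s ^ 2 - deriv y s ^ 2 = δ)
    (v₂ v₃ : ℝ) (hv : v₂ ^ 2 ≠ v₃ ^ 2)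
    (hsol : ∀ s ∈ I, (v₂ * deriv y s - v₃ * deriv x s) *
      (deriv y s * deriv (deriv x) s - deriv x s * deriv (deriv y) s) = 2) :
    ∃ s₀ : ℝ, ∀ s ∈ I,
      v₃ * deriv y s - v₂ * deriv x s = 2 * δ * (s - s₀) ∧
      (v₃ ^ 2 - v₂ ^ 2) * deriv x s ^ 2 - 4 * δ * v₂ * (s - s₀) * deriv x s -
        (4 * (s - s₀) ^ 2 + δ * v₃ ^ 2) = 0 ∧
      (s - s₀) ^ 2 + δ * (v₃ ^ 2 - v₂ ^ 2) / 4 ≥ 0 ∧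
      ∃ ε : ℝ, (ε = -1 ∨ ε = 1) ∧
        deriv x s = (2 * δ * v₂ * (s - s₀) +
          2 * ε * |v₃| * Real.sqrt ((s - s₀) ^ 2 + δ * (v₃ ^ 2 - v₂ ^ 2) / 4)) /
            (v₃ ^ 2 - v₂ ^ 2) := by
  have hδ2 : δ ^ 2 = 1 := by rcases hδ with rfl | rfl <;> norm_num
  have hδ0 : 2 * δ ≠ 0 := by rcases hδ with rfl | rfl <;> norm_num
  have hder : ∀ s ∈ I, HasDerivAt (fun s => v₃ * deriv y s - v₂ * deriv x s) (2 * δ) s := by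
    intro s hs
    have hp := hasDerivAt_deriv_of_contDiffOn hIopen hx hs
    have hq := hasDerivAt_deriv_of_contDiffOn hIopen hy hs
    have hconst : HasDerivAt (fun s => deriv x s ^ 2 - deriv y s ^ 2) 0 s :=
      (hasDerivAt_const s δ).congr_of_eventuallyEq
        (Filter.eventually_of_mem (hIopen.mem_nhds hs) harc)
    have horth := ((hp.pow 2).sub (hq.pow 2)).unique hconst
    norm_num at horth
    suffices v₃ * deriv (deriv y) s - v₂ * deriv (deriv x) s = 2 * δ from
      this ▸ (hq.const_mul v₃).sub (hp.const_mul v₂)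
    have ha := harc s hs
    have hs' := hsol s hs
    generalize deriv (deriv x) s = p' at *
    generalize deriv (deriv y) s = q' at *
    generalize deriv x s = p at *
    generalize deriv y s = q at *
    have hmul : δ * (v₃ * q' - v₂ * p') = 2 := by
      rw [← hs', ← ha]
      linear_combination (v₃ * q - v₂ * p) / 2 * horth
    linear_combination δ * hmul - (v₃ * q' - v₂ * p') * hδ2
  obtain ⟨s₀, hs₀⟩ := exists_eq_mul_sub_of_hasDerivAt hIopen hIconn hδ0 hder
  refine ⟨s₀, fun s hs => ?_⟩
  have hlin := hs₀ s hs
  have ha := harc s hs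
  generalize deriv x s = p at *
  generalize deriv y s = q at *
  generalize s - s₀ = u at *
  have hA : v₃ ^ 2 - v₂ ^ 2 ≠ 0 := sub_ne_zero.mpr hv.symm
  have hu : 4 * u ^ 2 = (v₃ * q - v₂ * p) ^ 2 := by
    rw [hlin]
    linear_combination (-4 * u ^ 2) * hδ2
  have hD : u ^ 2 + δ * (v₃ ^ 2 - v₂ ^ 2) / 4 = ((v₃ * p - v₂ * q) / 2) ^ 2 := by
    linear_combination hu / 4 - (v₃ ^ 2 - v₂ ^ 2) / 4 * ha
  obtain ⟨ε, hε, hεa⟩ := exists_sign_mul_abs (v₃ * (v₃ * p - v₂ * q))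
  refine ⟨hlin, ?_, hD ▸ sq_nonneg _, ε, hε, ?_⟩
  · linear_combination (2 * v₂ * p) * hlin - hu + v₃ ^ 2 * ha
  · rw [hD, Real.sqrt_sq_eq_abs, abs_div, abs_two, eq_div_iff hA]
    rw [abs_mul] at hεa
    linear_combination hεa + v₂ * hlin
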